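/- Let μ be a Borel probability measure of full support on the compact metric space M. Let g : Ω → ℝ be continuous with g > 0 and ∫_M g(ax) dμ(a) = 1 for all x ∈ Ω, and suppose that log g satisfies the weak Walters condition. Let L denote the Ruelle operator with weight g, i.e. Lφ(x) = ∫_M g(ax) φ(ax) dμ(a). Then there exists a Borel probability measure ν on Ω such that for every continuous φ : Ω → ℝ, L^n φ converges uniformly on Ω to the constant ∫_Ω φ dν. Moreover, ν is the unique Borel probability measure satisfying ∫_Ω Lφ dν = ∫_Ω φ dν for all continuous φ. -/

import Mathlib

open MeasureTheory Filter

noncomputable section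

namespace Paper

variable {M : Type*} [MetricSpace M]

/-- Prepend one symbol: `ax = (a, x₁, x₂, …)`. -/
def cons (a : M) (x : ℕ → M) : ℕ → M
  | 0 => a
  | n + 1 => x n

/-- Prepend a finite word `a ∈ Mⁿ`. -/
def consW {n : ℕ} (a : Fin n → M) (x : ℕ → M) : ℕ → M :=
  fun k => if h : k < n then a ⟨k, h⟩ else x (k - n)

/-- The left shift `σ`. -/
def shift (x : ℕ → M) : ℕ → M := fun n => x (n + 1)

/-- Birkhoff sum `Sₙ f = f + f∘σ + … + f∘σ^{n-1}`. -/
def birk (f : (ℕ → M) → ℝ) (n : ℕ) (x : ℕ → M) : ℝ :=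
  ∑ i ∈ Finset.range n, f (shift^[i] x)

/-- The metric `d_Ω(x,y) = Σ_{n≥1} 2^{-n} d(xₙ,yₙ)`. -/
def dOmega (x y : ℕ → M) : ℝ :=
  ∑' n : ℕ, (1 / 2 : ℝ) ^ (n + 1) * dist (x n) (y n)

/-- `dₙ(x,y) = max_{0 ≤ k < n} d_Ω(σᵏx, σᵏy)`. -/
def dN (n : ℕ) (x y : ℕ → M) : ℝ :=
  ⨆ k : Fin n, dOmega (shift^[(k : ℕ)] x) (shift^[(k : ℕ)] y)

/-- The (strong) Walters condition. -/
def Walters (f : (ℕ → M) → ℝ) : Prop :=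
  ∀ ε : ℝ, 0 < ε → ∃ η : ℝ, 0 < η ∧ ∀ n : ℕ, 1 ≤ n → ∀ x y : ℕ → M,
    dN n x y ≤ η → |birk f n x - birk f n y| ≤ ε

/-- `C_f(x,y) = sup_{n ≥ 1} sup_{a ∈ Mⁿ} (Sₙf(ax) − Sₙf(ay))`, a value in `(−∞,+∞]`. -/
def Cf (f : (ℕ → M) → ℝ) (x y : ℕ → M) : EReal :=
  ⨆ n : ℕ, ⨆ a : Fin (n + 1) → M,
    ((birk f (n + 1) (consW a x) - birk f (n + 1) (consW a y) : ℝ) : EReal)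

/-- The weak Walters condition. -/
def WeakWalters (f : (ℕ → M) → ℝ) : Prop :=
  ∀ ε : ℝ, 0 < ε → ∃ δ : ℝ, 0 < δ ∧ ∀ x y : ℕ → M,
    dOmega x y ≤ δ → Cf f x y ≤ (ε : EReal)

variable [MeasurableSpace M]

/-- The Ruelle operator `L_f φ(x) = ∫_M e^{f(ax)} φ(ax) dμ(a)`. -/
def ruelle (μ : Measure M) (f : (ℕ → M) → ℝ) (φ : (ℕ → M) → ℝ) : (ℕ → M) → ℝ :=
  fun x => ∫ a, Real.exp (f (cons a x)) * φ (cons a x) ∂μ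

/-- The Ruelle operator with weight `g`: `Lφ(x) = ∫_M g(ax) φ(ax) dμ(a)`. -/
def ruelleG (μ : Measure M) (g : (ℕ → M) → ℝ) (φ : (ℕ → M) → ℝ) : (ℕ → M) → ℝ :=
  fun x => ∫ a, g (cons a x) * φ (cons a x) ∂μ

/-! ### Words and Birkhoff sums -/

section Words

variable {M : Type*}

lemma continuous_cons [TopologicalSpace M] :
    Continuous fun p : M × (ℕ → M) => (cons p.1 p.2 : ℕ → M) := by
  refine continuous_pi fun n => ?_
  cases n with
  | zero => exact continuous_fst
  | succ n => exact (continuous_apply n).comp continuous_snd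

lemma continuous_comp_cons [TopologicalSpace M] {f : (ℕ → M) → ℝ} (hf : Continuous f) (x : ℕ → M) :
    Continuous fun a => f (cons a x) :=
  hf.comp (continuous_cons.comp (.prodMk_left x))

lemma shift_iterate_apply (z : ℕ → M) (n k : ℕ) : shift^[n] z k = z (k + n) := by
  induction n generalizing k with
  | zero => rfl
  | succ n ih =>
    rw [Function.iterate_succ_apply']
    exact (ih (k + 1)).trans (congrArg z (by omega))

lemma shift_iterate_eq_cons {z x : ℕ → M} {n : ℕ} (h : shift^[n + 1] z = x) :
    shift^[n] z = cons (z n) x := by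
  funext k
  cases k with
  | zero => simp [shift_iterate_apply, cons]
  | succ k => simp [← h, shift_iterate_apply, cons]; congr 1; omega

lemma shift_iterate_succ_of_eq_cons {z x : ℕ → M} {n : ℕ} {a : M}
    (h : shift^[n] z = cons a x) : shift^[n + 1] z = x := by
  rw [Function.iterate_succ_apply', h]
  rfl

lemma birk_succ (f : (ℕ → M) → ℝ) (n : ℕ) (z : ℕ → M) :
    birk f (n + 1) z = birk f n z + f (shift^[n] z) :=
  Finset.sum_range_succ _ _

lemma consW_eq {z x : ℕ → M} {n : ℕ} (h : shift^[n] z = x) :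
    consW (fun i : Fin n => z i) x = z := by
  funext k
  by_cases hk : k < n
  · simp [consW, hk]
  · simp only [consW, hk, dite_false, ← h, shift_iterate_apply]
    congr 1
    omega

lemma birk_sub_le_of_Cf_le {f : (ℕ → M) → ℝ} {x y z w : ℕ → M} {ε : ℝ} (hε : 0 ≤ ε)
    (hC : Cf f x y ≤ (ε : EReal)) {n : ℕ} (hzw : ∀ i < n, z i = w i)
    (hz : shift^[n] z = x) (hw : shift^[n] w = y) : birk f n z - birk f n w ≤ ε := by
  cases n with
  | zero => simpa [birk] using hε
  | succ n =>
    have h := (le_iSup₂ (f := fun (n : ℕ) (a : Fin (n + 1) → M) =>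
      ((birk f (n + 1) (consW a x) - birk f (n + 1) (consW a y) : ℝ) : EReal))
      n (fun i : Fin (n + 1) => z i)).trans hC
    rw [EReal.coe_le_coe_iff, consW_eq hz] at h
    have : (fun i : Fin (n + 1) => z i) = fun i : Fin (n + 1) => w i :=
      funext fun i => hzw i i.2
    rwa [this, consW_eq hw] at h

end Words

/-! ### The metric on the sequence space -/

section Metric

variable {M : Type*} [MetricSpace M]

@[simp]
lemma dOmega_self (x : ℕ → M) : dOmega x x = 0 := by simp [dOmega]

lemma summable_dOmega_bound :
    Summable fun n : ℕ => (1 / 2 : ℝ) ^ (n + 1) * Metric.diam (Set.univ : Set M) :=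
  ((summable_nat_add_iff 1).2 summable_geometric_two).mul_right _

variable [CompactSpace M]

lemma dOmega_term_le (x y : ℕ → M) (n : ℕ) :
    ‖(1 / 2 : ℝ) ^ (n + 1) * dist (x n) (y n)‖ ≤
      (1 / 2 : ℝ) ^ (n + 1) * Metric.diam (Set.univ : Set M) := by
  rw [Real.norm_of_nonneg (by positivity)]
  gcongr
  exact Metric.dist_le_diam_of_mem isCompact_univ.isBounded trivial trivial

lemma summable_dOmega (x y : ℕ → M) :
    Summable fun n : ℕ => (1 / 2 : ℝ) ^ (n + 1) * dist (x n) (y n) :=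
  summable_dOmega_bound.of_norm_bounded (dOmega_term_le x y)

lemma continuous_dOmega : Continuous fun p : (ℕ → M) × (ℕ → M) => dOmega p.1 p.2 :=
  continuous_tsum (fun n => by fun_prop) summable_dOmega_bound
    fun n p => dOmega_term_le p.1 p.2 n

lemma dOmega_pos {x y : ℕ → M} (h : x ≠ y) : 0 < dOmega x y := by
  obtain ⟨n, hn⟩ := Function.ne_iff.1 h
  have := dist_pos.2 hn
  exact (summable_dOmega x y).tsum_pos (fun _ => by positivity) n (by positivity)

lemma dOmega_le_shift {z w : ℕ → M} (h : z 0 = w 0) :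
    dOmega z w ≤ dOmega (shift z) (shift w) := by
  rw [dOmega, (summable_dOmega z w).tsum_eq_zero_add]
  simp only [h, dist_self, mul_zero, zero_add]
  refine Summable.tsum_le_tsum (fun n => ?_) ((summable_nat_add_iff 1).2 (summable_dOmega z w))
    (summable_dOmega _ _)
  exact mul_le_mul_of_nonneg_right
    (pow_le_pow_of_le_one (by norm_num) (by norm_num) (Nat.le_succ _)) dist_nonneg

lemma dOmega_le_shift_iterate {z w : ℕ → M} {n : ℕ} (h : ∀ i < n, z i = w i) :
    dOmega z w ≤ dOmega (shift^[n] z) (shift^[n] w) := by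
  induction n with
  | zero => rfl
  | succ n ih =>
    refine (ih fun i hi => h i (by omega)).trans ?_
    rw [Function.iterate_succ_apply', Function.iterate_succ_apply']
    exact dOmega_le_shift (by simpa [shift_iterate_apply] using h n (by omega))

/-- Continuous functions on `Ω` are uniformly continuous for `dOmega`. -/
lemma exists_abs_sub_lt_of_dOmega_lt {φ : (ℕ → M) → ℝ} (hφ : Continuous φ) {ε : ℝ} (hε : 0 < ε) :
    ∃ δ > 0, ∀ z w, dOmega z w < δ → |φ z - φ w| < ε := by
  have hK : IsCompact {p : (ℕ → M) × (ℕ → M) | ε ≤ |φ p.1 - φ p.2|} :=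
    (isClosed_le continuous_const (by fun_prop)).isCompact
  rcases Set.eq_empty_or_nonempty {p : (ℕ → M) × (ℕ → M) | ε ≤ |φ p.1 - φ p.2|} with h | h
  · refine ⟨1, one_pos, fun z w _ => ?_⟩
    by_contra! hzw
    exact (h ▸ hzw : (z, w) ∈ (∅ : Set ((ℕ → M) × (ℕ → M))))
  · obtain ⟨p, hp, hmin⟩ := hK.exists_isMinOn h continuous_dOmega.continuousOn
    refine ⟨dOmega p.1 p.2, dOmega_pos fun he => ?_, fun z w hzw => ?_⟩
    · simp only [Set.mem_ofPred_eq, he, sub_self, abs_zero] at hp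
      exact hε.not_ge hp
    · by_contra! hge
      exact (isMinOn_iff.1 hmin (z, w) hge).not_gt hzw

lemma eventually_dOmega_lt (x : ℕ → M) {δ : ℝ} (hδ : 0 < δ) : ∀ᶠ y in nhds x, dOmega x y < δ :=
  (continuous_dOmega.comp (.prodMk_right x)).tendsto x |>.eventually_lt_const (by simpa)

end Metric

/-! ### Markov operators on spaces of continuous functions -/

section Markov

variable {X : Type*} [TopologicalSpace X]
  {T : C(X, ℝ) →ₗ[ℝ] C(X, ℝ)}

lemma markov_iterate_one (hone : T 1 = 1) (n : ℕ) : T^[n] 1 = 1 :=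
  Function.iterate_fixed hone n

lemma markov_iterate_nonneg (hpos : ∀ φ, 0 ≤ φ → 0 ≤ T φ) (n : ℕ) {φ : C(X, ℝ)} (hφ : 0 ≤ φ) :
    0 ≤ T^[n] φ := by
  induction n with
  | zero => exact hφ
  | succ n ih =>
    rw [Function.iterate_succ_apply']
    exact hpos _ ih

variable [CompactSpace X]

lemma markov_norm_le (hpos : ∀ φ, 0 ≤ φ → 0 ≤ T φ) (hone : T 1 = 1) (φ : C(X, ℝ)) :
    ‖T φ‖ ≤ ‖φ‖ := by
  refine (ContinuousMap.norm_le _ (norm_nonneg _)).2 fun x => abs_le.2 ⟨?_, ?_⟩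
  · have h := hpos (φ + ‖φ‖ • 1) fun y => by
      have := (abs_le.1 (φ.norm_coe_le_norm y)).1
      simp
      linarith
    have := h x
    simp [hone] at this
    linarith
  · have h := hpos (‖φ‖ • 1 - φ) fun y => by
      have := (abs_le.1 (φ.norm_coe_le_norm y)).2
      simp
      linarith
    have := h x
    simp [hone] at this
    linarith

lemma markov_iterate_norm_le (hpos : ∀ φ, 0 ≤ φ → 0 ≤ T φ) (hone : T 1 = 1) (φ : C(X, ℝ))
    (n : ℕ) : ‖T^[n] φ‖ ≤ ‖φ‖ := by
  induction n with
  | zero => rfl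
  | succ n ih =>
    rw [Function.iterate_succ_apply']
    exact (markov_norm_le hpos hone _).trans ih

lemma markov_continuous (hpos : ∀ φ, 0 ≤ φ → 0 ≤ T φ) (hone : T 1 = 1) : Continuous T :=
  (T.mkContinuous 1 fun φ => by simpa using markov_norm_le hpos hone φ).continuous

/-- If all orbits of a Markov operator converge to constants, then it is uniquely ergodic. -/
theorem exists_unique_invariant_of_tendsto_const [T2Space X]
    [TopologicalSpace.PseudoMetrizableSpace X] [Nonempty X] [MeasurableSpace X] [BorelSpace X]
    (hpos : ∀ φ, 0 ≤ φ → 0 ≤ T φ) (hone : T 1 = 1)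
    (hlim : ∀ φ : C(X, ℝ), ∃ c : ℝ,
      Tendsto (fun n => T^[n] φ) atTop (nhds (ContinuousMap.const X c))) :
    ∃ ν : Measure X, IsProbabilityMeasure ν ∧
      (∀ φ : C(X, ℝ), Tendsto (fun n => T^[n] φ) atTop
        (nhds (ContinuousMap.const X (∫ z, φ z ∂ν)))) ∧
      (∀ φ : C(X, ℝ), ∫ z, T φ z ∂ν = ∫ z, φ z ∂ν) ∧
      (∀ ν' : Measure X, IsProbabilityMeasure ν' →
        (∀ φ : C(X, ℝ), ∫ z, T φ z ∂ν' = ∫ z, φ z ∂ν') → ν' = ν) := by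
  choose Λ hΛ using hlim
  have hconst {a b : ℝ} (h : ContinuousMap.const X a = ContinuousMap.const X b) : a = b :=
    DFunLike.congr_fun h (Classical.arbitrary X)
  have hadd (φ ψ) : Λ (φ + ψ) = Λ φ + Λ ψ := hconst <| tendsto_nhds_unique (hΛ _) <| by
    simpa [← Module.End.pow_apply] using! (hΛ φ).add (hΛ ψ)
  have hsmul (r : ℝ) (φ) : Λ (r • φ) = r * Λ φ := hconst <| tendsto_nhds_unique (hΛ _) <| by
    simpa [← Module.End.pow_apply] using! (hΛ φ).const_smul r
  have hnonneg (φ : C(X, ℝ)) (hφ : 0 ≤ φ) : 0 ≤ Λ φ := by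
    have x := Classical.arbitrary X
    refine ge_of_tendsto (((continuous_eval_const (F := C(X, ℝ)) x).tendsto _).comp (hΛ φ)) ?_
    exact .of_forall fun n => markov_iterate_nonneg hpos n hφ x
  have hΛone : Λ 1 = 1 := hconst <| tendsto_nhds_unique (hΛ 1) <| by
    simp only [markov_iterate_one hone]
    exact tendsto_const_nhds
  have hΛT (φ) : Λ (T φ) = Λ φ := hconst <| tendsto_nhds_unique (hΛ _) <|
    (tendsto_add_atTop_iff_nat (f := fun n => T^[n] φ) 1).2 (hΛ φ)
  let P : CompactlySupportedContinuousMap X ℝ →ₚ[ℝ] ℝ := PositiveLinearMap.mk₀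
    { toFun := fun φ => Λ φ.toContinuousMap
      map_add' := fun φ ψ => hadd _ _
      map_smul' := fun r φ => hsmul _ _ } fun φ hφ => hnonneg _ hφ
  have hint (φ : C(X, ℝ)) : ∫ z, φ z ∂(RealRMK.rieszMeasure P) = Λ φ :=
    RealRMK.integral_rieszMeasure P (CompactlySupportedContinuousMap.continuousMapEquiv φ)
  have hprob : IsProbabilityMeasure (RealRMK.rieszMeasure P) := by
    have := (hint 1).trans hΛone
    simp only [ContinuousMap.one_apply, integral_const, smul_eq_mul, mul_one] at this
    exact isProbabilityMeasure_iff_real.2 this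
  refine ⟨RealRMK.rieszMeasure P, hprob, fun φ => ?_, fun φ => ?_, fun ν' hν' hinv => ?_⟩
  · rw [hint]
    exact hΛ φ
  · rw [hint, hint, hΛT]
  · refine ext_of_forall_integral_eq_of_IsFiniteMeasure fun φ => ?_
    refine Eq.trans ?_ (hint φ.toContinuousMap).symm
    have hn (n : ℕ) : ∫ z, (T^[n] φ.toContinuousMap) z ∂ν' = ∫ z, φ z ∂ν' := by
      induction n with
      | zero => rfl
      | succ n ih => rw [Function.iterate_succ_apply', hinv, ih]
    have hcont : Continuous fun ψ : C(X, ℝ) => ∫ z, ψ z ∂ν' := by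
      refine (LipschitzWith.of_dist_le_mul (K := 1) fun ψ χ => ?_).continuous
      rw [dist_eq_norm, ← integral_sub (ψ.continuous.integrable_of_hasCompactSupport
        (.of_compactSpace _)) (χ.continuous.integrable_of_hasCompactSupport (.of_compactSpace _))]
      refine (norm_integral_le_of_norm_le_const (C := dist ψ χ)
        (.of_forall fun z => ?_)).trans (by simp)
      simpa [dist_eq_norm] using! ContinuousMap.dist_apply_le_dist (f := ψ) (g := χ) z
    have h := (hcont.tendsto _).comp (hΛ φ.toContinuousMap)
    simpa [Function.comp_def, hn] using h

/-- If an orbit of a Markov operator accumulates at a constant, it converges to it. -/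
lemma markov_tendsto_const_of_subseq (hpos : ∀ φ, 0 ≤ φ → 0 ≤ T φ) (hone : T 1 = 1)
    {φ : C(X, ℝ)} {c : ℝ} {k : ℕ → ℕ}
    (h : Tendsto (fun n => T^[k n] φ) atTop (nhds (ContinuousMap.const X c))) :
    Tendsto (fun n => T^[n] φ) atTop (nhds (ContinuousMap.const X c)) := by
  have hc : T (ContinuousMap.const X c) = ContinuousMap.const X c := by
    have : ContinuousMap.const X c = c • 1 := by ext; simp
    rw [this, map_smul, hone]
  have hanti : Antitone fun n => ‖T^[n] φ - ContinuousMap.const X c‖ := by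
    refine antitone_nat_of_succ_le fun n => ?_
    have := markov_norm_le hpos hone (T^[n] φ - ContinuousMap.const X c)
    rwa [map_sub, hc, ← Function.iterate_succ_apply' T] at this
  rw [Metric.tendsto_atTop] at h ⊢
  intro ε hε
  obtain ⟨N, hN⟩ := h ε hε
  refine ⟨k N, fun n hn => ?_⟩
  have := hN N le_rfl
  rw [dist_eq_norm] at this ⊢
  exact (hanti hn).trans_lt this

/-- Arzelà–Ascoli for orbits in `C(X, ℝ)`. -/
lemma exists_tendsto_subseq_of_equicontinuous {u : ℕ → C(X, ℝ)}
    (hu : Equicontinuous fun n => (u n : X → ℝ)) {B : ℝ} (hB : ∀ n, ‖u n‖ ≤ B) :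
    ∃ h : C(X, ℝ), ∃ k : ℕ → ℕ, StrictMono k ∧ Tendsto (u ∘ k) atTop (nhds h) := by
  have hK : IsCompact (closure (Set.range u)) := by
    have : T2Space (UniformOnFun X ℝ {K : Set X | IsCompact K}) :=
      UniformOnFun.t2Space_of_covering
        (Set.eq_univ_of_forall fun x => ⟨{x}, isCompact_singleton, rfl⟩)
    refine ArzelaAscoli.isCompact_closure_of_isClosedEmbedding (𝔖 := {K : Set X | IsCompact K})
      (F := fun f : C(X, ℝ) => (f : X → ℝ)) (fun _ hK => hK)
      ContinuousMap.isUniformEmbedding_toUniformOnFunIsCompact.isClosedEmbedding ?_ ?_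
    · refine fun K _ => Equicontinuous.equicontinuousOn ?_ K
      intro x U hU
      filter_upwards [hu x U hU] with y hy
      rintro ⟨_, n, rfl⟩
      exact hy n
    · refine fun K _ x _ => ⟨Metric.closedBall 0 B, isCompact_closedBall _ _, ?_⟩
      rintro _ ⟨n, rfl⟩
      simpa using ((u n).norm_coe_le_norm x).trans (hB n)
  obtain ⟨h, -, k, hk, hlim⟩ :=
    hK.tendsto_subseq fun n => subset_closure (Set.mem_range_self n)
  exact ⟨h, k, hk, hlim⟩

/-- Any accumulation point of an orbit of a Markov operator has iterates with constant maximum. -/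
lemma markov_exists_max_of_subseq [Nonempty X] (hpos : ∀ φ, 0 ≤ φ → 0 ≤ T φ) (hone : T 1 = 1)
    {φ h : C(X, ℝ)} {k : ℕ → ℕ} (hk : StrictMono k)
    (hlim : Tendsto (fun n => T^[k n] φ) atTop (nhds h)) :
    ∃ c : ℝ, (∀ x, h x ≤ c) ∧ ∀ m, ∃ x, T^[m] h x = c := by
  have hbdd (ψ : C(X, ℝ)) : BddAbove (Set.range ψ) := (isCompact_range ψ.continuous).bddAbove
  have hcont : Continuous fun ψ : C(X, ℝ) => ⨆ x, ψ x := by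
    refine (LipschitzWith.of_le_add fun ψ χ => ciSup_le fun x => ?_).continuous
    have h1 := le_ciSup (hbdd χ) x
    have h2 := (abs_le.1 (ContinuousMap.dist_apply_le_dist (f := ψ) (g := χ) x)).2
    linarith
  have hle (ψ : C(X, ℝ)) : ⨆ x, T ψ x ≤ ⨆ x, ψ x := by
    refine ciSup_le fun x => ?_
    have h := hpos ((⨆ y, ψ y) • 1 - ψ) (fun y => by simpa using le_ciSup (hbdd ψ) y) x
    simpa [hone] using h
  have hanti : Antitone fun n => ⨆ x, T^[n] φ x := by
    refine antitone_nat_of_succ_le fun n => ?_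
    rw [Function.iterate_succ_apply']
    exact hle _
  have hbelow : BddBelow (Set.range fun n => ⨆ x, T^[n] φ x) := by
    refine ⟨-‖φ‖, ?_⟩
    rintro _ ⟨n, rfl⟩
    have hn := markov_iterate_norm_le hpos hone φ n
    have x := Classical.arbitrary X
    have h1 := (abs_le.1 ((T^[n] φ).norm_coe_le_norm x)).1
    have h2 := le_ciSup (hbdd (T^[n] φ)) x
    linarith
  have hconv := tendsto_atTop_ciInf hanti hbelow
  set c := ⨅ n, ⨆ x, T^[n] φ x
  have hsup (m : ℕ) : ⨆ x, T^[m] h x = c := by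
    have h1 : Tendsto (fun n => ⨆ x, T^[m] (T^[k n] φ) x) atTop (nhds (⨆ x, T^[m] h x)) :=
      ((hcont.comp ((markov_continuous hpos hone).iterate m)).tendsto h).comp hlim
    refine tendsto_nhds_unique h1 ?_
    simp only [← Function.iterate_add_apply]
    exact hconv.comp (tendsto_atTop_mono (fun n => Nat.le_add_left _ m) hk.tendsto_atTop)
  refine ⟨c, fun x => hsup 0 ▸ le_ciSup (hbdd h) x, fun m => ?_⟩
  obtain ⟨x, -, hx⟩ := isCompact_univ.exists_isMaxOn Set.univ_nonempty
    (T^[m] h).continuous.continuousOn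
  refine ⟨x, le_antisymm (hsup m ▸ le_ciSup (hbdd _) x) (hsup m ▸ ciSup_le fun y => ?_)⟩
  exact isMaxOn_iff.1 hx y trivial

end Markov

/-! ### The Ruelle operator on continuous functions -/

section Ruelle

variable {M : Type*} [MetricSpace M] [MeasurableSpace M] [CompactSpace M] [BorelSpace M]
  {μ : Measure M} [IsFiniteMeasure μ] {g : (ℕ → M) → ℝ}

lemma integrable_of_continuous {f : M → ℝ} (hf : Continuous f) : Integrable f μ :=
  hf.integrable_of_hasCompactSupport (.of_compactSpace f)

lemma continuous_ruelleG (hg : Continuous g) {φ : (ℕ → M) → ℝ} (hφ : Continuous φ) :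
    Continuous (ruelleG μ g φ) := by
  have h : Continuous fun p : (ℕ → M) × M => g (cons p.2 p.1) * φ (cons p.2 p.1) :=
    (hg.mul hφ).comp (continuous_cons.comp continuous_swap)
  have := continuous_parametric_integral_of_continuous (μ := μ)
    (f := fun x a => g (cons a x) * φ (cons a x)) h isCompact_univ
  simpa only [Measure.restrict_univ] using! this

/-- The Ruelle operator with continuous weight `g`, acting on `C(Ω, ℝ)`. -/
def ruelleOp (μ : Measure M) [IsFiniteMeasure μ] (hg : Continuous g) :
    C(ℕ → M, ℝ) →ₗ[ℝ] C(ℕ → M, ℝ) where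
  toFun φ := ⟨ruelleG μ g φ, continuous_ruelleG hg φ.continuous⟩
  map_add' φ ψ := by
    ext x
    simp only [ContinuousMap.coe_mk, ruelleG, ContinuousMap.add_apply, mul_add]
    exact integral_add (integrable_of_continuous (continuous_comp_cons (hg.mul φ.continuous) x))
      (integrable_of_continuous (continuous_comp_cons (hg.mul ψ.continuous) x))
  map_smul' r φ := by
    ext x
    simp only [ContinuousMap.coe_mk, ruelleG, ContinuousMap.smul_apply, smul_eq_mul,
      RingHom.id_apply, ← integral_const_mul]
    congr 1
    ext a
    ring

lemma ruelleOp_apply (hg : Continuous g) (φ : C(ℕ → M, ℝ)) (x : ℕ → M) :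
    ruelleOp μ hg φ x = ∫ a, g (cons a x) * φ (cons a x) ∂μ := rfl

lemma coe_ruelleOp_iterate (hg : Continuous g) (φ : C(ℕ → M, ℝ)) (n : ℕ) :
    ⇑((ruelleOp μ hg)^[n] φ) = (ruelleG μ g)^[n] φ := by
  induction n with
  | zero => rfl
  | succ n ih =>
    rw [Function.iterate_succ_apply', Function.iterate_succ_apply', ← ih]
    rfl

/-- Comparing `Lⁿφ` at two points reduces to comparing the integrands word by word. -/
lemma ruelleOp_iterate_le (hg : Continuous g) (hgpos : ∀ x, 0 < g x) {φ ψ : C(ℕ → M, ℝ)}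
    (n : ℕ) {p q : ℝ} {x y : ℕ → M}
    (h : ∀ z w : ℕ → M, (∀ i < n, z i = w i) → shift^[n] z = x → shift^[n] w = y →
      p * (Real.exp (birk (fun x => Real.log (g x)) n z) * φ z) ≤
        q * (Real.exp (birk (fun x => Real.log (g x)) n w) * ψ w)) :
    p * (ruelleOp μ hg)^[n] φ x ≤ q * (ruelleOp μ hg)^[n] ψ y := by
  induction n generalizing p q x y with
  | zero => simpa [birk] using h x y (by simp) rfl rfl
  | succ n ih =>
    simp only [Function.iterate_succ_apply', ruelleOp_apply, ← integral_const_mul]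
    refine integral_mono
      (integrable_of_continuous
        (continuous_comp_cons (hg.mul ((ruelleOp μ hg)^[n] φ).continuous) x) |>.const_mul p)
      (integrable_of_continuous
        (continuous_comp_cons (hg.mul ((ruelleOp μ hg)^[n] ψ).continuous) y) |>.const_mul q)
      fun a => ?_
    simp only [← mul_assoc]
    refine ih fun z w hzw hz hw => ?_
    have key := h z w (fun i hi => ?_) (shift_iterate_succ_of_eq_cons hz)
      (shift_iterate_succ_of_eq_cons hw)
    · rw [birk_succ, birk_succ, hz, hw, Real.exp_add, Real.exp_add, Real.exp_log (hgpos _),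
        Real.exp_log (hgpos _)] at key
      linarith
    · rcases Nat.lt_succ_iff_lt_or_eq.1 hi with hi | rfl
      · exact hzw i hi
      · have h1 : shift^[i] z 0 = shift^[i] w 0 := by rw [hz, hw]; rfl
        simpa [shift_iterate_apply] using h1

lemma ruelleOp_nonneg (hg : Continuous g) (hgpos : ∀ x, 0 < g x) (φ : C(ℕ → M, ℝ)) (hφ : 0 ≤ φ) :
    0 ≤ ruelleOp μ hg φ :=
  fun _ => integral_nonneg fun _ => mul_nonneg (hgpos _).le (hφ _)

lemma ruelleOp_one (hg : Continuous g) (hgnorm : ∀ x : ℕ → M, ∫ a, g (cons a x) ∂μ = 1) :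
    ruelleOp μ hg 1 = 1 := by
  ext x
  simpa [ruelleOp_apply] using hgnorm x

lemma ruelleOp_iterate_sub_le (hg : Continuous g) (hgpos : ∀ x, 0 < g x)
    (hgnorm : ∀ x : ℕ → M, ∫ a, g (cons a x) ∂μ = 1) {φ : C(ℕ → M, ℝ)} (hφ : 0 ≤ φ) {ε : ℝ}
    (hε : 0 ≤ ε) {x y : ℕ → M} (hC : Cf (fun x => Real.log (g x)) x y ≤ (ε : EReal))
    (hxy : ∀ z w, dOmega z w ≤ dOmega x y → φ z ≤ φ w + ε) (n : ℕ) :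
    (ruelleOp μ hg)^[n] φ x - (ruelleOp μ hg)^[n] φ y ≤
      (Real.exp ε - 1) * ‖φ‖ + Real.exp ε * ε := by
  have key : 1 * (ruelleOp μ hg)^[n] φ x ≤
      Real.exp ε * (ruelleOp μ hg)^[n] (φ + ε • 1) y := by
    refine ruelleOp_iterate_le hg hgpos n fun z w hzw hz hw => ?_
    have h1 := birk_sub_le_of_Cf_le hε hC hzw hz hw
    have h2 := hxy z w (hz ▸ hw ▸ dOmega_le_shift_iterate hzw)
    rw [one_mul, ← mul_assoc, ← Real.exp_add]
    refine mul_le_mul (Real.exp_le_exp.2 (by linarith)) (by simpa using h2) (hφ z)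
      (Real.exp_pos _).le
  have hadd : (ruelleOp μ hg)^[n] (φ + ε • 1) y = (ruelleOp μ hg)^[n] φ y + ε := by
    have h1 := markov_iterate_one (ruelleOp_one (μ := μ) hg hgnorm) n
    simp only [← Module.End.pow_apply] at h1 ⊢
    rw [map_add, map_smul, h1]
    simp
  have h3 : (ruelleOp μ hg)^[n] φ y ≤ ‖φ‖ :=
    (le_abs_self _).trans ((ContinuousMap.norm_coe_le_norm _ y).trans
      (markov_iterate_norm_le (ruelleOp_nonneg hg hgpos) (ruelleOp_one hg hgnorm) φ n))
  rw [hadd, one_mul] at key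
  nlinarith [mul_le_mul_of_nonneg_left h3 (sub_nonneg.2 (Real.one_le_exp hε))]

lemma equicontinuous_ruelleOp_iterate (hg : Continuous g) (hgpos : ∀ x, 0 < g x)
    (hgnorm : ∀ x : ℕ → M, ∫ a, g (cons a x) ∂μ = 1)
    (hWW : WeakWalters fun x => Real.log (g x)) (φ : C(ℕ → M, ℝ)) :
    Equicontinuous fun n => ((ruelleOp μ hg)^[n] φ : (ℕ → M) → ℝ) := by
  set ψ : C(ℕ → M, ℝ) := φ + ‖φ‖ • 1 with hψ
  have hψ0 : 0 ≤ ψ := fun y => by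
    have := (abs_le.1 (φ.norm_coe_le_norm y)).1
    simp [hψ]
    linarith
  have hdiff (n : ℕ) (x y : ℕ → M) : (ruelleOp μ hg)^[n] φ x - (ruelleOp μ hg)^[n] φ y =
      (ruelleOp μ hg)^[n] ψ x - (ruelleOp μ hg)^[n] ψ y := by
    have h1 := markov_iterate_one (ruelleOp_one (μ := μ) hg hgnorm) n
    simp only [hψ, ← Module.End.pow_apply] at h1 ⊢
    rw [map_add, map_smul, h1]
    simp
  intro x
  rw [Metric.equicontinuousAt_iff_right]
  intro η hη
  obtain ⟨ε, hε, hεη⟩ : ∃ ε > 0, (Real.exp ε - 1) * ‖ψ‖ + Real.exp ε * ε < η := by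
    have hc : Continuous fun ε : ℝ => (Real.exp ε - 1) * ‖ψ‖ + Real.exp ε * ε := by fun_prop
    have hev := (hc.tendsto 0).eventually_lt_const (by simpa using hη)
    obtain ⟨ε, h1, h2⟩ := ((hev.filter_mono nhdsWithin_le_nhds).and
      (self_mem_nhdsWithin : Set.Ioi (0 : ℝ) ∈ nhdsWithin 0 (Set.Ioi 0))).exists
    exact ⟨ε, h2, h1⟩
  obtain ⟨δ₁, hδ₁, hW⟩ := hWW ε hε
  obtain ⟨δ₂, hδ₂, hU⟩ := exists_abs_sub_lt_of_dOmega_lt ψ.continuous hε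
  filter_upwards [eventually_dOmega_lt x (lt_min hδ₁ hδ₂)] with y hy n
  have hsymm : dOmega y x = dOmega x y := by simp only [dOmega, dist_comm]
  have hbound {u v : ℕ → M} (huv : dOmega u v < min δ₁ δ₂) :=
    ruelleOp_iterate_sub_le hg hgpos hgnorm hψ0 hε.le
      (hW u v (huv.le.trans (min_le_left _ _)))
      (fun z w hzw => by
        have := (abs_lt.1 (hU z w (hzw.trans_lt (huv.trans_le (min_le_right _ _))))).2
        linarith) n
  rw [Real.dist_eq, hdiff]
  exact abs_lt.2 ⟨by linarith [hbound (hsymm.trans_lt hy)], by linarith [hbound hy]⟩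

/-- If `h ≤ c` and `Lᵐh` attains `c` at `x`, then `h = c` on all `m`-th preimages of `x`. -/
lemma eq_of_ruelleOp_iterate_eq [μ.IsOpenPosMeasure] (hg : Continuous g) (hgpos : ∀ x, 0 < g x)
    (hgnorm : ∀ x : ℕ → M, ∫ a, g (cons a x) ∂μ = 1) {h : C(ℕ → M, ℝ)} {c : ℝ}
    (hc : ∀ x, h x ≤ c) {m : ℕ} {x : ℕ → M} (hx : (ruelleOp μ hg)^[m] h x = c)
    {z : ℕ → M} (hz : shift^[m] z = x) : h z = c := by
  induction m generalizing x with
  | zero => rwa [show z = x from hz]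
  | succ m ih =>
    refine ih ?_ (shift_iterate_eq_cons hz)
    set f := (ruelleOp μ hg)^[m] h with hf
    have hfc (y : ℕ → M) : f y ≤ c := by
      have h0 := markov_iterate_nonneg (ruelleOp_nonneg (μ := μ) hg hgpos) m
        (φ := c • 1 - h) (fun y => by simpa using hc y) y
      have h1 := markov_iterate_one (ruelleOp_one (μ := μ) hg hgnorm) m
      simp only [hf, ← Module.End.pow_apply] at h0 h1 ⊢
      rw [map_sub, map_smul, h1] at h0
      simpa using h0
    have hcont : Continuous fun a => g (cons a x) * (c - f (cons a x)) :=
      continuous_comp_cons (hg.mul (continuous_const.sub f.continuous)) x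
    have hnonneg : 0 ≤ fun a => g (cons a x) * (c - f (cons a x)) :=
      fun a => mul_nonneg (hgpos _).le (sub_nonneg.2 (hfc _))
    have hzero : ∫ a, g (cons a x) * (c - f (cons a x)) ∂μ = 0 := by
      rw [Function.iterate_succ_apply', ruelleOp_apply, ← hf] at hx
      simp only [mul_sub]
      refine (integral_sub
        ((integrable_of_continuous (continuous_comp_cons hg x)).mul_const c)
        (integrable_of_continuous (continuous_comp_cons (hg.mul f.continuous) x))).trans ?_
      rw [integral_mul_const, hgnorm, one_mul]
      exact sub_eq_zero.2 hx.symm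
    rw [integral_eq_zero_iff_of_nonneg hnonneg (integrable_of_continuous hcont),
      hcont.ae_eq_iff_eq μ continuous_zero] at hzero
    have := congrFun hzero (z m)
    simp only [Pi.zero_apply, mul_eq_zero, (hgpos _).ne', false_or] at this
    linarith

lemma exists_tendsto_const_ruelleOp_iterate [Nonempty M] [μ.IsOpenPosMeasure]
    (hg : Continuous g) (hgpos : ∀ x, 0 < g x)
    (hgnorm : ∀ x : ℕ → M, ∫ a, g (cons a x) ∂μ = 1)
    (hWW : WeakWalters fun x => Real.log (g x)) (φ : C(ℕ → M, ℝ)) :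
    ∃ c : ℝ, Tendsto (fun n => (ruelleOp μ hg)^[n] φ) atTop
      (nhds (ContinuousMap.const (ℕ → M) c)) := by
  have hpos := ruelleOp_nonneg (μ := μ) hg hgpos
  have hone := ruelleOp_one (μ := μ) hg hgnorm
  obtain ⟨h, k, hk, hlim⟩ := exists_tendsto_subseq_of_equicontinuous
    (equicontinuous_ruelleOp_iterate hg hgpos hgnorm hWW φ)
    (markov_iterate_norm_le hpos hone φ)
  obtain ⟨c, hc, hmax⟩ := markov_exists_max_of_subseq hpos hone hk hlim
  choose x hx using hmax
  have hconst : h = ContinuousMap.const (ℕ → M) c := by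
    ext y
    have hy : Tendsto (fun m => consW (fun i : Fin m => y i) (x m)) atTop (nhds y) := by
      refine tendsto_pi_nhds.2 fun j => tendsto_const_nhds.congr' ?_
      filter_upwards [eventually_gt_atTop j] with m hm
      simp [consW, hm]
    refine tendsto_nhds_unique ((h.continuous.tendsto y).comp hy)
      (tendsto_const_nhds.congr fun m => ?_)
    refine (eq_of_ruelleOp_iterate_eq hg hgpos hgnorm hc (hx m) ?_).symm
    funext j
    simp [shift_iterate_apply, consW]
  exact ⟨c, markov_tendsto_const_of_subseq hpos hone (hconst ▸ hlim)⟩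

end Ruelle

/-- Let `μ` be a fully supported Borel probability measure on the compact
metric space `M`, and let `g > 0` be continuous with `∫ g(ax) dμ(a) = 1` for all `x`,
such that `log g` satisfies the weak Walters condition.  Then there is a Borel
probability measure `ν` on `Ω` such that `Lⁿφ → ∫ φ dν` uniformly for every continuous
`φ`, and `ν` is the unique probability measure with `∫ Lφ dν = ∫ φ dν` for all
continuous `φ`. -/
theorem statement11 [CompactSpace M] [BorelSpace M]
    (μ : Measure M) [IsProbabilityMeasure μ]
    (hsupp : ∀ U : Set M, IsOpen U → U.Nonempty → 0 < μ U)
    (g : (ℕ → M) → ℝ) (hg : Continuous g) (hgpos : ∀ x, 0 < g x)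
    (hgnorm : ∀ x : ℕ → M, ∫ a, g (cons a x) ∂μ = 1)
    (hWW : WeakWalters fun x => Real.log (g x)) :
    ∃ ν : Measure (ℕ → M), IsProbabilityMeasure ν ∧
      (∀ φ : (ℕ → M) → ℝ, Continuous φ →
        TendstoUniformly (fun n : ℕ => (ruelleG μ g)^[n] φ)
          (fun _ => ∫ z, φ z ∂ν) atTop) ∧
      (∀ φ : (ℕ → M) → ℝ, Continuous φ →
        ∫ z, ruelleG μ g φ z ∂ν = ∫ z, φ z ∂ν) ∧
      (∀ ν' : Measure (ℕ → M), IsProbabilityMeasure ν' →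
        (∀ φ : (ℕ → M) → ℝ, Continuous φ →
          ∫ z, ruelleG μ g φ z ∂ν' = ∫ z, φ z ∂ν') → ν' = ν) := by
  have : Nonempty M := μ.nonempty_of_neZero
  have : μ.IsOpenPosMeasure := ⟨fun U hU hne => (hsupp U hU hne).ne'⟩
  obtain ⟨ν, hν, hlim, hinv, huniq⟩ := exists_unique_invariant_of_tendsto_const
    (ruelleOp_nonneg hg hgpos) (ruelleOp_one hg hgnorm)
    (exists_tendsto_const_ruelleOp_iterate hg hgpos hgnorm hWW)
  refine ⟨ν, hν, fun φ hφ => ?_, fun φ hφ => hinv ⟨φ, hφ⟩,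
    fun ν' hν' h => huniq ν' hν' fun φ => h φ φ.continuous⟩
  have := ContinuousMap.tendsto_iff_tendstoUniformly.1 (hlim ⟨φ, hφ⟩)
  simpa only [coe_ruelleOp_iterate] using! this

end Paper
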